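/- For every integer m ≥ 0, the eigenspace {u a function on K_{m+1} : −Δ_{m+1} u = u} has dimension exactly 5^m, and every function u in this eigenspace vanishes at all old vertices, i.e., u(5n) = 0 for every n ∈ ℤ/N_mℤ (taking 5n in ℤ/N_{m+1}ℤ). -/

import Mathlib

open scoped BigOperators

noncomputable section

namespace VNLE

/-- `N_m = 2·5^m`, the number of points on the circle at level `m`. -/
def Nm (m : ℕ) : ℕ := 2 * 5 ^ m

/-- The partner of a vertex `n` of `K_m`: writing the representative `v` of `n`
(taking `v = 2·5^m` when `n = 0`) as `v = 5^k·a` with `5 ∤ a`, the partner is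
`n + 5^k` if `a ≡ 1` or `3 (mod 5)`, and `n - 5^k` if `a ≡ 2` or `4 (mod 5)`.
This realizes the identifications `5^k(1+5j) ∼ 5^k(2+5j)` and
`5^k(3+5j) ∼ 5^k(4+5j)` in `ℤ/(2·5^m)ℤ`. -/
def partner (m : ℕ) (n : ZMod (Nm m)) : ZMod (Nm m) :=
  let v : ℕ := if n.val = 0 then Nm m else n.val
  let k : ℕ := padicValNat 5 v
  if (v / 5 ^ k) % 5 = 1 ∨ (v / 5 ^ k) % 5 = 3 then n + ((5 ^ k : ℕ) : ZMod (Nm m))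
  else n - ((5 ^ k : ℕ) : ZMod (Nm m))

/-- A function on `K_m`: a map on `ℤ/N_mℤ` constant on the identified pairs. -/
def IsKFun (m : ℕ) (u : ZMod (Nm m) → ℝ) : Prop := ∀ n, u (partner m n) = u n

/-- The graph Laplacian `−Δ_m`. -/
def lap (m : ℕ) (u : ZMod (Nm m) → ℝ) : ZMod (Nm m) → ℝ := fun n =>
  4 * u n - u (n + 1) - u (n - 1) - u (partner m n + 1) - u (partner m n - 1)

/-- `u` is a `λ`-eigenfunction of `−Δ_m`. -/
def IsEigen (m : ℕ) (lam : ℝ) (u : ZMod (Nm m) → ℝ) : Prop :=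
  IsKFun m u ∧ u ≠ 0 ∧ ∀ n, lap m u n = lam * u n

/-- The spectral decimation renormalization polynomial `R(x) = x(3−x)(5−x)`. -/
def R (x : ℝ) : ℝ := x * (3 - x) * (5 - x)

/-- The `λ'`-extension of a function on `K_m` to a function on `K_{m+1}`. -/
def extFun (m : ℕ) (lam' : ℝ) (u : ZMod (Nm m) → ℝ) : ZMod (Nm (m + 1)) → ℝ := fun x =>
  let n : ZMod (Nm m) := ((x.val / 5 : ℕ) : ZMod (Nm m))
  if x.val % 5 = 0 then u n
  else if x.val % 5 = 1 ∨ x.val % 5 = 2 then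
    ((2 - lam') * u n + u (n + 1)) / ((1 - lam') * (3 - lam'))
  else
    (u n + (2 - lam') * u (n + 1)) / ((1 - lam') * (3 - lam'))

/-- Restriction of a function on `K_{m+1}` to the old vertices, giving a function on `K_m`. -/
def down (m : ℕ) (v : ZMod (Nm (m + 1)) → ℝ) : ZMod (Nm m) → ℝ := fun n =>
  v (((5 * n.val : ℕ) : ZMod (Nm (m + 1))))

/-- The Laplacian `−Δ_m` as a linear map. -/
def lapL (m : ℕ) : (ZMod (Nm m) → ℝ) →ₗ[ℝ] (ZMod (Nm m) → ℝ) where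
  toFun := lap m
  map_add' u v := by funext n; simp only [lap, Pi.add_apply]; ring
  map_smul' c u := by funext n; simp only [lap, Pi.smul_apply, smul_eq_mul, RingHom.id_apply]; ring

/-- The subspace of functions on `K_m` (maps constant on identified pairs). -/
def KFunSub (m : ℕ) : Submodule ℝ (ZMod (Nm m) → ℝ) where
  carrier := {u | IsKFun m u}
  add_mem' := by
    intro u v hu hv n
    simp only [Pi.add_apply, hu n, hv n]
  zero_mem' := fun _ => rfl
  smul_mem' := by
    intro c u hu n
    simp only [Pi.smul_apply, hu n]

/-- The `λ`-eigenspace of `−Δ_m` inside the space of functions on `K_m`. -/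
def eigensp (m : ℕ) (lam : ℝ) : Submodule ℝ (ZMod (Nm m) → ℝ) :=
  LinearMap.ker (lapL m - lam • LinearMap.id) ⊓ KFunSub m

/-- `c = (8 − √19)/3`, the smaller critical point of `R`. -/
def cpt : ℝ := (8 - Real.sqrt 19) / 3

/-- `φ₁`, the inverse of the (strictly increasing) restriction of `R` to `[0, c]`. -/
def phi1 : ℝ → ℝ := Function.invFunOn R (Set.Icc 0 cpt)

/-- Eigenvalue counting function: total dimension of the eigenspaces of `−Δ_m`
with eigenvalue `≤ t`. -/
def evCount (m : ℕ) (t : ℝ) : ℕ :=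
  Module.finrank ℝ ↥(⨆ lam ∈ Set.Iic t, eigensp m lam)

/-- `evSorted m k = λ_k(m)`, the `k`-th smallest eigenvalue (with multiplicity,
`1 ≤ k ≤ 5^m`) of `−Δ_m` acting on functions on `K_m`. -/
def evSorted (m k : ℕ) : ℝ := sInf {t : ℝ | k ≤ evCount m t}

/-- The restriction of a function on the circle `ℝ/ℤ` to the level-`m` vertices. -/
def restr (u : AddCircle (1 : ℝ) → ℝ) (m : ℕ) : ZMod (Nm m) → ℝ := fun n =>
  u (((n.val : ℝ) / (Nm m : ℝ) : ℝ) : AddCircle (1 : ℝ))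

/-- A continuous function on the circle is admissible if at every level its values
agree on identified pairs, so that its restrictions are functions on `K_m`. -/
def Admissible (u : AddCircle (1 : ℝ) → ℝ) : Prop :=
  Continuous u ∧ ∀ m, 1 ≤ m → ∀ n : ZMod (Nm m), restr u m (partner m n) = restr u m n

/-- `u` is a `λ`-eigenfunction of `−Δ` on `K`: it is admissible, nonzero, and
`sup_n |15^m (−Δ_m u_m)(n) − λ u(n/N_m)| → 0` as `m → ∞`. -/
def IsEigenK (lam : ℝ) (u : AddCircle (1 : ℝ) → ℝ) : Prop :=
  Admissible u ∧ u ≠ 0 ∧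
    ∀ ε : ℝ, 0 < ε → ∃ M : ℕ, ∀ m, M ≤ m → ∀ n : ZMod (Nm m),
      |(15 : ℝ) ^ m * lap m (restr u m) n - lam * restr u m n| < ε

/-- The symmetry-type subspace `V_{ε₁,ε₂}` of functions on `K_m`. -/
def symSub (m : ℕ) (e1 e2 : ℝ) : Submodule ℝ (ZMod (Nm m) → ℝ) where
  carrier := {u | IsKFun m u ∧ (∀ n, u (-n) = e1 * u n) ∧
    (∀ n, u (((5 ^ m : ℕ) : ZMod (Nm m)) - n) = e2 * u n)}
  add_mem' := by
    rintro u v ⟨hu, hu1, hu2⟩ ⟨hv, hv1, hv2⟩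
    refine ⟨fun n => by simp only [Pi.add_apply, hu n, hv n],
      fun n => by simp only [Pi.add_apply, hu1 n, hv1 n]; ring,
      fun n => by simp only [Pi.add_apply, hu2 n, hv2 n]; ring⟩
  zero_mem' := ⟨fun _ => rfl, fun n => by simp, fun n => by simp⟩
  smul_mem' := by
    rintro c u ⟨hu, hu1, hu2⟩
    refine ⟨fun n => by simp only [Pi.smul_apply, hu n],
      fun n => by simp only [Pi.smul_apply, smul_eq_mul, hu1 n]; ring,
      fun n => by simp only [Pi.smul_apply, smul_eq_mul, hu2 n]; ring⟩

instance neZero_Nm (m : ℕ) : NeZero (Nm m) := ⟨by simp [Nm]⟩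

lemma Nm_succ (m : ℕ) : Nm (m + 1) = 5 * Nm m := by simp only [Nm, pow_succ]; ring

/-- The inclusion `j ↦ 5j` of the old vertices, as a map of circles. -/
def emb (m : ℕ) : ZMod (Nm m) →+ ZMod (Nm (m + 1)) :=
  ZMod.lift (Nm m) ⟨zmultiplesHom _ 5, by
    have h : ((Nm (m + 1) : ℕ) : ZMod (Nm (m + 1))) = 0 := ZMod.natCast_self _
    rw [Nm_succ m] at h ⊢
    push_cast at h
    simpa [mul_comm] using h⟩

lemma emb_apply (m : ℕ) (j : ZMod (Nm m)) :
    emb m j = ((5 * j.val : ℕ) : ZMod (Nm (m + 1))) := by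
  conv_lhs => rw [← ZMod.natCast_zmod_val j, ← Int.cast_natCast]
  rw [emb, ZMod.lift_coe]
  simp [mul_comm]

lemma emb_natCast (m n : ℕ) : emb m (n : ZMod (Nm m)) = 5 * (n : ZMod (Nm (m + 1))) := by
  rw [← Int.cast_natCast, emb, ZMod.lift_coe]
  simp [mul_comm]

lemma emb_one (m : ℕ) : emb m 1 = 5 := by simpa using emb_natCast m 1

lemma val_emb_add (m : ℕ) (j : ZMod (Nm m)) {r : ℕ} (hr : r < 5) :
    (emb m j + (r : ZMod (Nm (m + 1)))).val = 5 * j.val + r := by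
  rw [emb_apply, ← Nat.cast_add, ZMod.val_natCast_of_lt]
  have := ZMod.val_lt j
  rw [Nm_succ]
  omega

lemma val_emb (m : ℕ) (j : ZMod (Nm m)) : (emb m j).val = 5 * j.val := by
  simpa using val_emb_add m j (r := 0) (by norm_num)

lemma exists_eq_emb_add (m : ℕ) (x : ZMod (Nm (m + 1))) :
    ∃ j : ZMod (Nm m), ∃ r : ℕ, r < 5 ∧ x = emb m j + (r : ZMod (Nm (m + 1))) := by
  refine ⟨((x.val / 5 : ℕ) : ZMod (Nm m)), x.val % 5, Nat.mod_lt _ (by norm_num), ?_⟩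
  have hx : x.val / 5 < Nm m := by
    have := ZMod.val_lt x
    have := Nm_succ m
    omega
  rw [emb_apply, ZMod.val_natCast_of_lt hx, ← Nat.cast_add, Nat.div_add_mod,
    ZMod.natCast_zmod_val]

lemma partner_emb_add (m : ℕ) (j : ZMod (Nm m)) {r : ℕ} (hr0 : r ≠ 0) (hr : r < 5) :
    partner (m + 1) (emb m j + (r : ZMod (Nm (m + 1)))) =
      if r = 1 ∨ r = 3 then emb m j + r + 1 else emb m j + r - 1 := by
  have hk : padicValNat 5 (5 * j.val + r) = 0 := padicValNat.eq_zero_of_not_dvd (by omega)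
  have h0 : 5 * j.val + r ≠ 0 := by omega
  have hmod : (5 * j.val + r) % 5 = r := by omega
  simp only [partner, val_emb_add m j hr, h0, if_false, hk, pow_zero, Nat.div_one, hmod,
    Nat.cast_one]

lemma partner_emb_add_one (m : ℕ) (j : ZMod (Nm m)) :
    partner (m + 1) (emb m j + 1) = emb m j + 2 := by
  have := partner_emb_add m j (r := 1) (by norm_num) (by norm_num)
  norm_num at this
  rw [this]; ring

lemma partner_emb_add_two (m : ℕ) (j : ZMod (Nm m)) :
    partner (m + 1) (emb m j + 2) = emb m j + 1 := by
  have := partner_emb_add m j (r := 2) (by norm_num) (by norm_num)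
  norm_num at this
  rw [this]; ring

lemma partner_emb_add_three (m : ℕ) (j : ZMod (Nm m)) :
    partner (m + 1) (emb m j + 3) = emb m j + 4 := by
  have := partner_emb_add m j (r := 3) (by norm_num) (by norm_num)
  norm_num at this
  rw [this]; ring

lemma partner_emb_add_four (m : ℕ) (j : ZMod (Nm m)) :
    partner (m + 1) (emb m j + 4) = emb m j + 3 := by
  have := partner_emb_add m j (r := 4) (by norm_num) (by norm_num)
  norm_num at this
  rw [this]; ring

lemma partner_emb (m : ℕ) (j : ZMod (Nm m)) :
    partner (m + 1) (emb m j) = emb m (partner m j) := by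
  have hv : (if (emb m j).val = 0 then Nm (m + 1) else (emb m j).val) =
      5 * (if j.val = 0 then Nm m else j.val) := by
    rw [val_emb, Nm_succ]
    split_ifs <;> omega
  have hv0 : (if j.val = 0 then Nm m else j.val) ≠ 0 := by
    split_ifs with h
    · exact NeZero.ne _
    · exact h
  unfold partner
  rw [hv]
  generalize (if j.val = 0 then Nm m else j.val) = v at hv0
  have hk : padicValNat 5 (5 * v) = padicValNat 5 v + 1 := by
    have : Fact (Nat.Prime 5) := ⟨by norm_num⟩
    rw [padicValNat.mul (by norm_num) hv0, padicValNat_self, add_comm]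
  have hd : 5 * v / 5 ^ (padicValNat 5 v + 1) = v / 5 ^ padicValNat 5 v := by
    rw [pow_succ', Nat.mul_div_mul_left _ _ (by norm_num)]
  simp only [hk, hd]
  split_ifs
  · rw [map_add, emb_natCast]; push_cast; ring
  · rw [map_sub, emb_natCast]; push_cast; ring

/-- Induction along the decomposition of a level-`(m+1)` circle into old and new vertices. -/
lemma emb_cases (m : ℕ) {p : ZMod (Nm (m + 1)) → Prop} (h0 : ∀ j, p (emb m j))
    (h1 : ∀ j, p (emb m j + 1)) (h2 : ∀ j, p (emb m j + 2)) (h3 : ∀ j, p (emb m j + 3))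
    (h4 : ∀ j, p (emb m j + 4)) (x : ZMod (Nm (m + 1))) : p x := by
  obtain ⟨j, r, hr, rfl⟩ := exists_eq_emb_add m x
  interval_cases r
  · simpa using h0 j
  · simpa using h1 j
  · simpa using h2 j
  · simpa using h3 j
  · simpa using h4 j

lemma partner_eq_or (m : ℕ) (j : ZMod (Nm m)) :
    ∃ k : ℕ, partner m j = j + ((5 ^ k : ℕ) : ZMod (Nm m)) ∨
      j = partner m j + ((5 ^ k : ℕ) : ZMod (Nm m)) := by
  refine ⟨padicValNat 5 (if j.val = 0 then Nm m else j.val), ?_⟩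
  by_cases h : (((if j.val = 0 then Nm m else j.val) /
      5 ^ padicValNat 5 (if j.val = 0 then Nm m else j.val)) % 5 = 1 ∨
    ((if j.val = 0 then Nm m else j.val) /
      5 ^ padicValNat 5 (if j.val = 0 then Nm m else j.val)) % 5 = 3)
  · exact Or.inl (if_pos h)
  · right
    rw [show partner m j = _ from if_neg h]
    simp

/-- Parity of a point of the circle `ℤ/N_mℤ`. -/
def parity (m : ℕ) : ZMod (Nm m) →+* ZMod 2 := ZMod.castHom (Dvd.intro _ rfl) (ZMod 2)

lemma parity_pow_five (m k : ℕ) : parity m ((5 ^ k : ℕ) : ZMod (Nm m)) = 1 := by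
  rw [map_natCast, Nat.cast_pow, show ((5 : ℕ) : ZMod 2) = 1 from rfl, one_pow]

lemma parity_partner (m : ℕ) (j : ZMod (Nm m)) : parity m (partner m j) = parity m j + 1 := by
  obtain ⟨k, h | h⟩ := partner_eq_or m j
  · rw [h, map_add, parity_pow_five]
  · have h' := congrArg (parity m) h
    rw [map_add, parity_pow_five] at h'
    rw [h', add_assoc, show (1 : ZMod 2) + 1 = 0 from rfl, add_zero]

lemma partner_partner (m : ℕ) (j : ZMod (Nm m)) : partner m (partner m j) = j := by
  induction m with
  | zero =>
    have h : Function.Injective (parity 0) := by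
      change Function.Injective (ZMod.castHom (Dvd.intro _ rfl : 2 ∣ 2 * 5 ^ 0) (ZMod 2))
      decide
    apply h
    rw [parity_partner, parity_partner, add_assoc, show (1 : ZMod 2) + 1 = 0 from rfl, add_zero]
  | succ m ih =>
    refine emb_cases m (p := fun j => partner (m + 1) (partner (m + 1) j) = j) (fun j => ?_)
      (fun j => ?_) (fun j => ?_) (fun j => ?_) (fun j => ?_) j
    · rw [partner_emb, partner_emb, ih]
    · rw [partner_emb_add_one, partner_emb_add_two]
    · rw [partner_emb_add_two, partner_emb_add_one]
    · rw [partner_emb_add_three, partner_emb_add_four]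
    · rw [partner_emb_add_four, partner_emb_add_three]

/-- The partner map as a permutation. -/
def partnerEquiv (m : ℕ) : ZMod (Nm m) ≃ ZMod (Nm m) :=
  Function.Involutive.toPerm (partner m) (partner_partner m)

/-- An alternating function on `K_m` vanishes, since partners have opposite parity. -/
lemma eq_zero_of_alternating {m : ℕ} {y : ZMod (Nm m) → ℝ} (hP : ∀ j, y (partner m j) = y j)
    (hS : ∀ j, y (j + 1) = -y j) (j : ZMod (Nm m)) : y j = 0 := by
  have hn : ∀ (n : ℕ) j, y (j + (n : ZMod (Nm m))) = (-1) ^ n * y j := by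
    intro n
    induction n with
    | zero => simp
    | succ n ih => intro j; rw [Nat.cast_succ, ← add_assoc, hS, ih, pow_succ]; ring
  have h5 : ∀ (k : ℕ) j, y (j + ((5 ^ k : ℕ) : ZMod (Nm m))) = -y j := fun k j => by
    rw [hn, Odd.neg_one_pow (Odd.pow (by decide)), neg_one_mul]
  have hj := hP j
  obtain ⟨k, h | h⟩ := partner_eq_or m j
  · rw [h, h5] at hj; linarith
  · have h' := congrArg y h
    rw [h5] at h'
    linarith

/-- Maps adjoint for the dot product have kernels of the same dimension. -/
lemma finrank_ker_eq_of_adjoint {ι : Type*} [Fintype ι] [DecidableEq ι]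
    (f g : (ι → ℝ) →ₗ[ℝ] (ι → ℝ)) (h : ∀ x y, f x ⬝ᵥ y = x ⬝ᵥ g y) :
    Module.finrank ℝ (LinearMap.ker f) = Module.finrank ℝ (LinearMap.ker g) := by
  have hT : LinearMap.toMatrix' g = (LinearMap.toMatrix' f).transpose := by
    ext i j
    have := h (Pi.single i 1) (Pi.single j 1)
    simpa [LinearMap.toMatrix'_apply, Pi.single_apply] using this.symm
  have hr : Module.finrank ℝ (LinearMap.range f) = Module.finrank ℝ (LinearMap.range g) := by
    have := Matrix.rank_transpose (LinearMap.toMatrix' f)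
    rw [← hT, Matrix.rank, Matrix.rank, ← Matrix.toLin'_apply', ← Matrix.toLin'_apply',
      Matrix.toLin'_toMatrix', Matrix.toLin'_toMatrix'] at this
    exact this.symm
  have hf := f.finrank_range_add_finrank_ker
  have hg := g.finrank_range_add_finrank_ker
  omega

/-- The map `y ↦ y + y ∘ partner`. -/
def symmetrize (m : ℕ) : (ZMod (Nm m) → ℝ) →ₗ[ℝ] (ZMod (Nm m) → ℝ) :=
  LinearMap.id + LinearMap.funLeft ℝ ℝ (partner m)

lemma symmetrize_apply (m : ℕ) (y : ZMod (Nm m) → ℝ) (j : ZMod (Nm m)) :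
    symmetrize m y j = y j + y (partner m j) := rfl

lemma range_symmetrize (m : ℕ) : LinearMap.range (symmetrize m) = KFunSub m := by
  ext y
  constructor
  · rintro ⟨x, rfl⟩ j
    rw [symmetrize_apply, symmetrize_apply, partner_partner, add_comm]
  · intro hy
    refine ⟨(2⁻¹ : ℝ) • y, funext fun j => ?_⟩
    have := hy j
    simp only [symmetrize_apply, Pi.smul_apply, smul_eq_mul, this]
    ring

/-- The sign of the parity of a point. -/
def sgn (m : ℕ) (j : ZMod (Nm m)) : ℝ := if parity m j = 0 then 1 else -1

lemma sgn_mul_self (m : ℕ) (j : ZMod (Nm m)) : sgn m j * sgn m j = 1 := by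
  unfold sgn; split_ifs <;> norm_num

lemma sgn_partner (m : ℕ) (j : ZMod (Nm m)) : sgn m (partner m j) = -sgn m j := by
  have key : ∀ a : ZMod 2,
      (if a + 1 = 0 then (1 : ℝ) else -1) = -(if a = 0 then (1 : ℝ) else -1) := by
    intro a
    obtain rfl | rfl : a = 0 ∨ a = 1 := by decide +revert
    · simp
    · simp [show (1 : ZMod 2) + 1 = 0 from rfl]
  rw [sgn, parity_partner, key, sgn]

/-- Multiplication by the sign of the parity. -/
def sgnMul (m : ℕ) : (ZMod (Nm m) → ℝ) ≃ₗ[ℝ] (ZMod (Nm m) → ℝ) :=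
  LinearEquiv.ofInvolutive
    { toFun := fun y j => sgn m j * y j
      map_add' := fun x y => funext fun j => mul_add _ _ _
      map_smul' := fun c y => funext fun j => mul_left_comm _ _ _ }
    fun y => funext fun j => by
      change sgn m j * (sgn m j * y j) = y j
      rw [← mul_assoc, sgn_mul_self, one_mul]

lemma sgnMul_apply (m : ℕ) (y : ZMod (Nm m) → ℝ) (j : ZMod (Nm m)) :
    sgnMul m y j = sgn m j * y j := rfl

lemma ker_symmetrize_eq_comap (m : ℕ) :
    LinearMap.ker (symmetrize m) = (KFunSub m).comap (sgnMul m).toLinearMap := by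
  ext y
  rw [LinearMap.mem_ker, Submodule.mem_comap, funext_iff]
  refine forall_congr' fun j => ?_
  rw [LinearEquiv.coe_coe, sgnMul_apply, sgnMul_apply, sgn_partner, symmetrize_apply,
    Pi.zero_apply]
  constructor
  · intro h
    rw [eq_neg_of_add_eq_zero_right h]
    ring
  · intro h
    have h1 := congrArg (sgn m j * ·) h
    simp only [neg_mul, mul_neg, ← mul_assoc, sgn_mul_self, one_mul] at h1
    linarith

lemma finrank_ker_symmetrize (m : ℕ) :
    Module.finrank ℝ (LinearMap.ker (symmetrize m)) = 5 ^ m := by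
  have h1 := (symmetrize m).finrank_range_add_finrank_ker
  have h2 : Module.finrank ℝ (LinearMap.ker (symmetrize m)) = Module.finrank ℝ (KFunSub m) := by
    rw [ker_symmetrize_eq_comap, Submodule.comap_equiv_eq_map_symm]
    exact LinearEquiv.finrank_map_eq _ _
  rw [range_symmetrize, ← h2, Module.finrank_fintype_fun_eq_card, ZMod.card] at h1
  have h3 : Nm m = 2 * 5 ^ m := rfl
  omega

/-- The sum over the four cells meeting at a vertex; here `c j` is the value on the cell
between `j` and `j + 1`. -/
def cellSum (m : ℕ) : (ZMod (Nm m) → ℝ) →ₗ[ℝ] (ZMod (Nm m) → ℝ) :=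
  symmetrize m ∘ₗ (LinearMap.id + LinearMap.funLeft ℝ ℝ (· - 1))

lemma cellSum_apply (m : ℕ) (c : ZMod (Nm m) → ℝ) (j : ZMod (Nm m)) :
    cellSum m c j = c j + c (j - 1) + (c (partner m j) + c (partner m j - 1)) := rfl

/-- The transpose of `cellSum`. -/
def cellSumAdj (m : ℕ) : (ZMod (Nm m) → ℝ) →ₗ[ℝ] (ZMod (Nm m) → ℝ) :=
  (LinearMap.id + LinearMap.funLeft ℝ ℝ (· + 1)) ∘ₗ symmetrize m

lemma cellSumAdj_apply (m : ℕ) (y : ZMod (Nm m) → ℝ) (j : ZMod (Nm m)) :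
    cellSumAdj m y j = symmetrize m y j + symmetrize m y (j + 1) := rfl

lemma symmetrize_dotProduct (m : ℕ) (x y : ZMod (Nm m) → ℝ) :
    symmetrize m x ⬝ᵥ y = x ⬝ᵥ symmetrize m y := by
  simp only [dotProduct, symmetrize_apply, add_mul, mul_add, Finset.sum_add_distrib]
  congr 1
  refine Fintype.sum_equiv (partnerEquiv m) _ _ fun j => ?_
  change _ = x (partner m j) * y (partner m (partner m j))
  rw [partner_partner]

lemma cellSum_dotProduct (m : ℕ) (x y : ZMod (Nm m) → ℝ) :
    cellSum m x ⬝ᵥ y = x ⬝ᵥ cellSumAdj m y := by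
  rw [cellSum, LinearMap.comp_apply, symmetrize_dotProduct]
  simp only [dotProduct, cellSumAdj_apply, LinearMap.add_apply, LinearMap.id_apply, Pi.add_apply,
    LinearMap.funLeft_apply, add_mul, mul_add, Finset.sum_add_distrib]
  congr 1
  refine Fintype.sum_equiv (Equiv.subRight 1) _ _ fun j => ?_
  simp

lemma ker_cellSumAdj (m : ℕ) :
    LinearMap.ker (cellSumAdj m) = LinearMap.ker (symmetrize m) := by
  refine le_antisymm (fun y hy => ?_) (LinearMap.ker_le_ker_comp _ _)
  rw [LinearMap.mem_ker] at hy ⊢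
  have hK : symmetrize m y ∈ KFunSub m := range_symmetrize m ▸ LinearMap.mem_range_self _ y
  refine funext fun j => eq_zero_of_alternating hK (fun i => ?_) j
  exact eq_neg_of_add_eq_zero_right (congrFun hy i)

lemma finrank_ker_cellSum (m : ℕ) : Module.finrank ℝ (LinearMap.ker (cellSum m)) = 5 ^ m := by
  rw [finrank_ker_eq_of_adjoint _ _ (cellSum_dotProduct m), ker_cellSumAdj,
    finrank_ker_symmetrize]

/-- Extend cell values to the new vertices, with value zero at the old vertices. -/
def cellExt (m : ℕ) : (ZMod (Nm m) → ℝ) →ₗ[ℝ] (ZMod (Nm (m + 1)) → ℝ) where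
  toFun c x := if x.val % 5 = 0 then 0 else c ((x.val / 5 : ℕ) : ZMod (Nm m))
  map_add' c d := by
    funext x
    simp only [Pi.add_apply]
    split_ifs <;> simp
  map_smul' a c := by
    funext x
    simp only [Pi.smul_apply, RingHom.id_apply]
    split_ifs <;> simp

lemma cellExt_emb (m : ℕ) (c : ZMod (Nm m) → ℝ) (j : ZMod (Nm m)) :
    cellExt m c (emb m j) = 0 :=
  if_pos (by rw [val_emb, Nat.mul_mod_right])

lemma cellExt_emb_add (m : ℕ) (c : ZMod (Nm m) → ℝ) (j : ZMod (Nm m)) {r : ℕ} (hr0 : r ≠ 0)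
    (hr : r < 5) : cellExt m c (emb m j + (r : ZMod (Nm (m + 1)))) = c j := by
  have h1 : (5 * j.val + r) % 5 ≠ 0 := by omega
  have h2 : (5 * j.val + r) / 5 = j.val := by omega
  change (if _ then _ else _) = _
  rw [val_emb_add m j hr, if_neg h1, h2, ZMod.natCast_zmod_val]

lemma cellExt_emb_add_one (m : ℕ) (c : ZMod (Nm m) → ℝ) (j : ZMod (Nm m)) :
    cellExt m c (emb m j + 1) = c j := by
  simpa using cellExt_emb_add m c j (r := 1) (by norm_num) (by norm_num)

lemma cellExt_emb_add_two (m : ℕ) (c : ZMod (Nm m) → ℝ) (j : ZMod (Nm m)) :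
    cellExt m c (emb m j + 2) = c j := by
  simpa using cellExt_emb_add m c j (r := 2) (by norm_num) (by norm_num)

lemma cellExt_emb_add_three (m : ℕ) (c : ZMod (Nm m) → ℝ) (j : ZMod (Nm m)) :
    cellExt m c (emb m j + 3) = c j := by
  simpa using cellExt_emb_add m c j (r := 3) (by norm_num) (by norm_num)

lemma cellExt_emb_add_four (m : ℕ) (c : ZMod (Nm m) → ℝ) (j : ZMod (Nm m)) :
    cellExt m c (emb m j + 4) = c j := by
  simpa using cellExt_emb_add m c j (r := 4) (by norm_num) (by norm_num)

lemma cellExt_injective (m : ℕ) : Function.Injective (cellExt m) := fun c d h =>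
  funext fun j => by rw [← cellExt_emb_add_one m c j, h, cellExt_emb_add_one]

lemma emb_add_five (m : ℕ) (j : ZMod (Nm m)) : emb m j + 5 = emb m (j + 1) := by
  rw [map_add, emb_one]

lemma emb_sub_one (m : ℕ) (j : ZMod (Nm m)) : emb m j - 1 = emb m (j - 1) + 4 := by
  rw [map_sub, emb_one]; ring

lemma lap_emb (m : ℕ) (u : ZMod (Nm (m + 1)) → ℝ) (j : ZMod (Nm m)) :
    lap (m + 1) u (emb m j) = 4 * u (emb m j) - u (emb m j + 1) - u (emb m (j - 1) + 4) -
      u (emb m (partner m j) + 1) - u (emb m (partner m j - 1) + 4) := by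
  rw [lap, partner_emb, emb_sub_one, emb_sub_one]

lemma lap_emb_add_one (m : ℕ) (u : ZMod (Nm (m + 1)) → ℝ) (j : ZMod (Nm m)) :
    lap (m + 1) u (emb m j + 1) = 4 * u (emb m j + 1) - u (emb m j + 2) - u (emb m j) -
      u (emb m j + 3) - u (emb m j + 1) := by
  rw [lap, partner_emb_add_one]; ring_nf

lemma lap_emb_add_three (m : ℕ) (u : ZMod (Nm (m + 1)) → ℝ) (j : ZMod (Nm m)) :
    lap (m + 1) u (emb m j + 3) = 4 * u (emb m j + 3) - u (emb m j + 4) - u (emb m j + 2) -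
      u (emb m (j + 1)) - u (emb m j + 3) := by
  rw [lap, partner_emb_add_three, ← emb_add_five]; ring_nf

lemma lap_partner {m : ℕ} {u : ZMod (Nm m) → ℝ} (hu : IsKFun m u) (n : ZMod (Nm m)) :
    lap m u (partner m n) = lap m u n := by
  rw [lap, lap, partner_partner, hu]; ring

lemma mem_eigensp {m : ℕ} {lam : ℝ} {u : ZMod (Nm m) → ℝ} :
    u ∈ eigensp m lam ↔ (∀ n, lap m u n = lam * u n) ∧ IsKFun m u := by
  rw [eigensp, Submodule.mem_inf, LinearMap.mem_ker, LinearMap.sub_apply, sub_eq_zero,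
    funext_iff]
  rfl

/-- On a function in the `1`-eigenspace the values at old vertices vanish. -/
lemma eigensp_one_emb {m : ℕ} {u : ZMod (Nm (m + 1)) → ℝ} (hu : u ∈ eigensp (m + 1) 1)
    (j : ZMod (Nm m)) : u (emb m j) = 0 := by
  obtain ⟨hL, hK⟩ := mem_eigensp.1 hu
  refine eq_zero_of_alternating (y := fun j => u (emb m j)) (fun i => ?_) (fun i => ?_) j
  · rw [← partner_emb, hK]
  · have h1 := hL (emb m i + 1)
    have h3 := hL (emb m i + 3)
    have k1 := hK (emb m i + 1)
    have k3 := hK (emb m i + 3)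
    rw [lap_emb_add_one] at h1
    rw [lap_emb_add_three] at h3
    rw [partner_emb_add_one] at k1
    rw [partner_emb_add_three] at k3
    linarith

lemma cellExt_isKFun (m : ℕ) (c : ZMod (Nm m) → ℝ) : IsKFun (m + 1) (cellExt m c) := by
  refine emb_cases m (fun j => ?_) (fun j => ?_) (fun j => ?_) (fun j => ?_) (fun j => ?_)
  · rw [partner_emb, cellExt_emb, cellExt_emb]
  · rw [partner_emb_add_one, cellExt_emb_add_one, cellExt_emb_add_two]
  · rw [partner_emb_add_two, cellExt_emb_add_one, cellExt_emb_add_two]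
  · rw [partner_emb_add_three, cellExt_emb_add_three, cellExt_emb_add_four]
  · rw [partner_emb_add_four, cellExt_emb_add_three, cellExt_emb_add_four]

lemma lap_cellExt_emb (m : ℕ) (c : ZMod (Nm m) → ℝ) (j : ZMod (Nm m)) :
    lap (m + 1) (cellExt m c) (emb m j) = -cellSum m c j := by
  rw [lap_emb, cellSum_apply, cellExt_emb]
  simp only [cellExt_emb_add_one, cellExt_emb_add_four]
  ring

lemma cellExt_mem_eigensp {m : ℕ} {c : ZMod (Nm m) → ℝ} :
    cellExt m c ∈ eigensp (m + 1) 1 ↔ c ∈ LinearMap.ker (cellSum m) := by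
  rw [mem_eigensp, LinearMap.mem_ker]
  constructor
  · rintro ⟨hL, -⟩
    funext j
    have := hL (emb m j)
    rw [lap_cellExt_emb, cellExt_emb] at this
    simpa using this
  · intro hc
    refine ⟨?_, cellExt_isKFun m c⟩
    have h1 : ∀ j, lap (m + 1) (cellExt m c) (emb m j + 1) = 1 * cellExt m c (emb m j + 1) := by
      intro j
      rw [lap_emb_add_one, cellExt_emb, cellExt_emb_add_one, cellExt_emb_add_two,
        cellExt_emb_add_three]
      ring
    have h3 : ∀ j, lap (m + 1) (cellExt m c) (emb m j + 3) = 1 * cellExt m c (emb m j + 3) := by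
      intro j
      rw [lap_emb_add_three, cellExt_emb, cellExt_emb_add_two, cellExt_emb_add_three,
        cellExt_emb_add_four]
      ring
    refine emb_cases m (fun j => ?_) h1 (fun j => ?_) h3 (fun j => ?_)
    · rw [lap_cellExt_emb, hc, cellExt_emb]
      simp
    · rw [← partner_emb_add_one, lap_partner (cellExt_isKFun m c), cellExt_isKFun m c, h1]
    · rw [← partner_emb_add_three, lap_partner (cellExt_isKFun m c), cellExt_isKFun m c, h3]

lemma eigensp_one_eq_map (m : ℕ) :
    eigensp (m + 1) 1 = (LinearMap.ker (cellSum m)).map (cellExt m) := by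
  ext u
  rw [Submodule.mem_map]
  constructor
  · intro hu
    obtain ⟨hL, hK⟩ := mem_eigensp.1 hu
    have hext : cellExt m (fun j => u (emb m j + 1)) = u := by
      have k1 : ∀ j, u (emb m j + 2) = u (emb m j + 1) := fun j => by
        rw [← partner_emb_add_one, hK]
      have k3 : ∀ j, u (emb m j + 4) = u (emb m j + 3) := fun j => by
        rw [← partner_emb_add_three, hK]
      have e : ∀ j, u (emb m j + 3) = u (emb m j + 1) := fun j => by
        have h1 := hL (emb m j + 1)
        rw [lap_emb_add_one, k1, eigensp_one_emb hu] at h1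
        linarith
      refine funext (emb_cases m (fun j => ?_) (fun j => ?_) (fun j => ?_) (fun j => ?_)
        (fun j => ?_))
      · rw [cellExt_emb, eigensp_one_emb hu]
      · rw [cellExt_emb_add_one]
      · rw [cellExt_emb_add_two, k1]
      · rw [cellExt_emb_add_three, e]
      · rw [cellExt_emb_add_four, k3, e]
    exact ⟨_, cellExt_mem_eigensp.1 (hext.symm ▸ hu), hext⟩
  · rintro ⟨c, hc, rfl⟩
    exact cellExt_mem_eigensp.2 hc

/-- The `1`-eigenspace of `−Δ_{m+1}` has dimension `5^m`, and its
elements vanish at all old vertices. -/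
theorem eigenspace_one (m : ℕ) :
    Module.finrank ℝ ↥(eigensp (m + 1) 1) = 5 ^ m ∧
    ∀ u : ZMod (Nm (m + 1)) → ℝ, u ∈ eigensp (m + 1) 1 →
      ∀ n : ZMod (Nm m), u (((5 * n.val : ℕ) : ZMod (Nm (m + 1)))) = 0 := by
  refine ⟨?_, fun u hu n => emb_apply m n ▸ eigensp_one_emb hu n⟩
  rw [eigensp_one_eq_map, ← finrank_ker_cellSum m]
  exact (Submodule.equivMapOfInjective _ (cellExt_injective m) _).finrank_eq.symm

end VNLE
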